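/- Let α > 0 and let x ∈ (0,1) be irrational with regular continued fraction convergent denominators (Q_n)_{n≥0}. If Σ_{n=1}^{∞} log(Q_{n+1}) / Q_n^{α} < ∞, then the series Σ_{j=0}^{∞} e^{(iπ/4) Σ_{ℓ=0}^{j−1} σ(T^ℓ(x))} (Π_{ℓ=0}^{j−1} |T^ℓ(x)|)^{α} · log(1/|T^j(x)|) converges (i.e., its partial sums converge; empty products and sums for j = 0 are 1 and 0 respectively). -/

import Mathlib

open Complex Filter Finset

noncomputable section

/-- `ρ = e^{iπ/4}`. -/
def ρ : ℂ := Complex.exp (Real.pi * Complex.I / 4)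

/-- Partial sum `F_{s,n}(x,t) = Σ_{k=1}^{n} e^{iπk²x + 2πikt}/k^s`. -/
def Fpart (s : ℝ) (n : ℕ) (x t : ℝ) : ℂ :=
  ∑ k ∈ Finset.Icc 1 n,
    Complex.exp (Real.pi * Complex.I * (k : ℂ) ^ 2 * (x : ℂ)
        + 2 * Real.pi * Complex.I * (k : ℂ) * (t : ℂ)) / (k : ℂ) ^ (s : ℂ)

/-- The function `I_s(x,t)` (for `x > 0`). -/
def Ifun (s x t : ℝ) : ℂ :=
  (∫ u : ℝ, ρ *
      (Complex.exp (Real.pi * Complex.I * ((1 : ℂ) / 2 + ρ * (u : ℂ)) ^ 2 * (x : ℂ)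
            + 2 * Real.pi * Complex.I * ((1 : ℂ) / 2 + ρ * (u : ℂ)) * (Int.fract t : ℝ)) /
        (((1 : ℂ) / 2 + ρ * (u : ℂ)) ^ (s : ℂ) *
          (1 - Complex.exp (2 * Real.pi * Complex.I * ((1 : ℂ) / 2 + ρ * (u : ℂ)))))))
  + ρ * (x : ℂ) ^ (s : ℂ) *
    ∫ u : ℝ, (Real.exp (-(Real.pi * x * u ^ 2)) : ℝ) *
      ∑' k : ℕ, Complex.exp (-(Real.pi * Complex.I * (((k : ℂ) + 1) - (Int.fract t : ℝ)) ^ 2 / (x : ℂ))) *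
        (((ρ * (x : ℂ) * (u : ℂ) + ((k : ℂ) + 1) - (Int.fract t : ℝ)) ^ (s : ℂ))⁻¹
          - (((k : ℂ) + 1) ^ (s : ℂ))⁻¹)

/-- `Ω_s(x,t)`. -/
def Omega (s x t : ℝ) : ℂ :=
  if 0 < x then Ifun s x t else (starRingEnd ℂ) (Ifun s (-x) (-t))

/-- `Ω_s(x) = Ω_s(x,0)`. -/
def Omega0 (s x : ℝ) : ℂ := Omega s x 0

/-- The map `T(x) = -1/x mod 2`, valued in `(-1,1]`. -/
def Tmap (x : ℝ) : ℝ := -1 / x - 2 * ⌈((-1 / x) - 1) / 2⌉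

/-- Denominator `Q_n` of the `n`-th convergent of the regular continued fraction of `x`. -/
def Qden (x : ℝ) (n : ℕ) : ℝ := (GenContFract.of x).dens n

end

open scoped Topology

/-- The orbit of `x` under the Gauss map. -/
noncomputable def gaussOrbit (x : ℝ) : ℕ → ℝ
  | 0 => x
  | n + 1 => Int.fract (gaussOrbit x n)⁻¹

/-- The product of the first `n` points of the Gauss orbit of `x`. -/
noncomputable def gaussProd (x : ℝ) (n : ℕ) : ℝ := ∏ i ∈ Finset.range n, gaussOrbit x i

lemma gaussProd_succ (x : ℝ) (n : ℕ) :
    gaussProd x (n + 1) = gaussProd x n * gaussOrbit x n :=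
  Finset.prod_range_succ _ _

/-- The partial sums of the series of absolute values, defined by recursion on the first term. -/
noncomputable def absPartialSum (α : ℝ) : ℕ → ℝ → ℝ
  | 0, _ => 0
  | N + 1, x => Real.log (1 / |x|) + |x| ^ α * absPartialSum α N (Tmap x)

lemma absPartialSum_eq_sum (α : ℝ) (N : ℕ) (x : ℝ) :
    absPartialSum α N x = ∑ j ∈ Finset.range N,
      (∏ ℓ ∈ Finset.range j, |Tmap^[ℓ] x|) ^ α * Real.log (1 / |Tmap^[j] x|) := by
  induction N generalizing x with
  | zero => simp [absPartialSum]
  | succ N ih =>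
    rw [Finset.sum_range_succ', absPartialSum, ih, Finset.mul_sum, add_comm]
    congr 1
    · refine Finset.sum_congr rfl fun j _ => ?_
      rw [Finset.prod_range_succ', Real.mul_rpow (Finset.prod_nonneg fun _ _ => abs_nonneg _)
        (abs_nonneg _)]
      simp only [Function.iterate_succ_apply, Function.iterate_zero, id]
      ring
    · simp

lemma abs_Tmap_eq {x h : ℝ} {k : ℤ} (hk : 1 / |x| = 2 * k + h) (hh : |h| < 1) :
    |Tmap x| = |h| := by
  obtain ⟨h1, h2⟩ := abs_lt.1 hh
  rcases le_total 0 x with h0 | h0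
  · rw [abs_of_nonneg h0] at hk
    have e : -1 / x = -(2 * k + h) := by rw [← hk]; ring
    have : ⌈((-1 / x) - 1) / 2⌉ = -k := by
      rw [e, Int.ceil_eq_iff]; push_cast; constructor <;> linarith
    rw [Tmap, this, e, ← abs_neg]; push_cast; congr 1; ring
  · rw [abs_of_nonpos h0] at hk
    have e : -1 / x = 2 * k + h := by rw [← hk, neg_div, div_neg]
    have : ⌈((-1 / x) - 1) / 2⌉ = k := by
      rw [e, Int.ceil_eq_iff]; constructor <;> linarith
    rw [Tmap, this, e]; congr 1; ring

/-- The even-folding of `1/|z| = m + g` is `g` or `1 - g`, according to the parity of `m`. -/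
lemma abs_Tmap_eq_or {z g : ℝ} {m : ℤ} (hz : 1 / |z| = m + g) (h0 : 0 < g) (h1 : g < 1) :
    |Tmap z| = g ∨ |Tmap z| = 1 - g := by
  rcases Int.even_or_odd' m with ⟨k, rfl | rfl⟩
  · left
    rw [abs_Tmap_eq (k := k) (h := g) (by rw [hz]; push_cast; ring) (by rwa [abs_of_pos h0]),
      abs_of_pos h0]
  · right
    have : |g - 1| = 1 - g := by rw [abs_of_neg (by linarith)]; ring
    rw [abs_Tmap_eq (k := k + 1) (h := g - 1) (by rw [hz]; push_cast; ring)
      (by rw [this]; linarith), this]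

section GaussOrbit

variable {x : ℝ}

lemma irrational_gaussOrbit (hirr : Irrational x) (n : ℕ) : Irrational (gaussOrbit x n) := by
  induction n with
  | zero => exact hirr
  | succ n ih => exact (irrational_inv_iff.2 ih).sub_intCast _

lemma gaussOrbit_mem (hx : x ∈ Set.Ioo (0 : ℝ) 1) (hirr : Irrational x) (n : ℕ) :
    gaussOrbit x n ∈ Set.Ioo (0 : ℝ) 1 := by
  cases n with
  | zero => exact hx
  | succ n =>
    refine ⟨lt_of_le_of_ne (Int.fract_nonneg _) ?_, Int.fract_lt_one _⟩
    exact (irrational_gaussOrbit hirr (n + 1)).ne_zero.symm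

lemma inv_gaussOrbit (x : ℝ) (n : ℕ) :
    (gaussOrbit x n)⁻¹ = ⌊(gaussOrbit x n)⁻¹⌋ + gaussOrbit x (n + 1) :=
  (Int.floor_add_fract _).symm

lemma one_le_floor_inv_gaussOrbit (hx : x ∈ Set.Ioo (0 : ℝ) 1) (hirr : Irrational x) (n : ℕ) :
    1 ≤ ⌊(gaussOrbit x n)⁻¹⌋ := by
  obtain ⟨h0, h1⟩ := gaussOrbit_mem hx hirr n
  exact Int.le_floor.2 (by simpa using (one_le_inv₀ h0).2 h1.le)

lemma gaussProd_pos (hx : x ∈ Set.Ioo (0 : ℝ) 1) (hirr : Irrational x) (n : ℕ) :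
    0 < gaussProd x n :=
  Finset.prod_pos fun i _ => (gaussOrbit_mem hx hirr i).1

lemma stream_eq (hx : x ∈ Set.Ioo (0 : ℝ) 1) (hirr : Irrational x) (n : ℕ) :
    ∃ b, GenContFract.IntFractPair.stream x n = some ⟨b, gaussOrbit x n⟩ := by
  induction n with
  | zero =>
    refine ⟨⌊x⌋, ?_⟩
    simp [GenContFract.IntFractPair.stream_zero, GenContFract.IntFractPair.of, gaussOrbit,
      Int.fract_eq_self.2 ⟨hx.1.le, hx.2⟩]
  | succ n ih =>
    obtain ⟨b, hb⟩ := ih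
    exact ⟨_, GenContFract.IntFractPair.stream_succ_of_some hb (gaussOrbit_mem hx hirr n).1.ne'⟩

lemma get?_of_eq (hx : x ∈ Set.Ioo (0 : ℝ) 1) (hirr : Irrational x) (n : ℕ) :
    (GenContFract.of x).s.get? n = some ⟨1, (⌊(gaussOrbit x n)⁻¹⌋ : ℝ)⟩ := by
  obtain ⟨b, hb⟩ := stream_eq hx hirr n
  exact GenContFract.get?_of_eq_some_of_succ_get?_intFractPair_stream
    (GenContFract.IntFractPair.stream_succ_of_some hb (gaussOrbit_mem hx hirr n).1.ne')

lemma Qden_zero (x : ℝ) : Qden x 0 = 1 := GenContFract.zeroth_den_eq_one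

lemma Qden_one (hx : x ∈ Set.Ioo (0 : ℝ) 1) (hirr : Irrational x) :
    Qden x 1 = ⌊(gaussOrbit x 0)⁻¹⌋ :=
  GenContFract.first_den_eq (get?_of_eq hx hirr 0)

lemma Qden_add_two (hx : x ∈ Set.Ioo (0 : ℝ) 1) (hirr : Irrational x) (n : ℕ) :
    Qden x (n + 2) = ⌊(gaussOrbit x (n + 1))⁻¹⌋ * Qden x (n + 1) + Qden x n := by
  have := GenContFract.dens_recurrence (get?_of_eq hx hirr (n + 1)) (predB := Qden x (n + 1))
    (ppredB := Qden x n) rfl rfl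
  rw [one_mul] at this
  exact this

lemma one_le_Qden (hx : x ∈ Set.Ioo (0 : ℝ) 1) (hirr : Irrational x) (n : ℕ) :
    1 ≤ Qden x n := by
  have ha : ∀ n, (1 : ℝ) ≤ ⌊(gaussOrbit x n)⁻¹⌋ := fun n => by
    exact_mod_cast one_le_floor_inv_gaussOrbit hx hirr n
  suffices h : 1 ≤ Qden x n ∧ 1 ≤ Qden x (n + 1) from h.1
  induction n with
  | zero => exact ⟨(Qden_zero x).ge, (Qden_one hx hirr) ▸ ha 0⟩
  | succ n ih =>
    refine ⟨ih.2, ?_⟩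
    rw [Qden_add_two hx hirr]
    nlinarith [ha (n + 1), ih.1, ih.2]

lemma gaussProd_mul_Qden_add (hx : x ∈ Set.Ioo (0 : ℝ) 1) (hirr : Irrational x) (n : ℕ) :
    gaussProd x (n + 1) * (Qden x (n + 1) + gaussOrbit x (n + 1) * Qden x n) = 1 := by
  have hg := fun n => (gaussOrbit_mem hx hirr n).1.ne'
  induction n with
  | zero =>
    rw [Qden_zero, Qden_one hx hirr, mul_one, ← inv_gaussOrbit]
    simp [gaussProd, hg 0]
  | succ n ih =>
    have h1 := mul_inv_cancel₀ (hg (n + 1))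
    rw [gaussProd_succ, Qden_add_two hx hirr, ← ih]
    rw [inv_gaussOrbit x (n + 1)] at h1
    linear_combination gaussProd x (n + 1) * Qden x (n + 1) * h1

lemma gaussProd_le_inv_Qden (hx : x ∈ Set.Ioo (0 : ℝ) 1) (hirr : Irrational x) (n : ℕ) :
    gaussProd x (n + 1) ≤ (Qden x (n + 1))⁻¹ := by
  have hQ := one_le_Qden hx hirr
  rw [le_inv_comm₀ (gaussProd_pos hx hirr _) (by linarith [hQ (n + 1)]), inv_eq_of_mul_eq_one_right
    (gaussProd_mul_Qden_add hx hirr n)]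
  nlinarith [hQ n, (gaussOrbit_mem hx hirr (n + 1)).1]

lemma log_two_div_gaussOrbit_le (hx : x ∈ Set.Ioo (0 : ℝ) 1) (hirr : Irrational x) (n : ℕ) :
    Real.log (2 / gaussOrbit x (n + 1)) ≤ 3 * Real.log (Qden x (n + 2)) := by
  have hQ := one_le_Qden hx hirr
  have ha : (1 : ℝ) ≤ ⌊(gaussOrbit x (n + 1))⁻¹⌋ := by
    exact_mod_cast one_le_floor_inv_gaussOrbit hx hirr (n + 1)
  have hg := gaussOrbit_mem hx hirr (n + 1)
  have hr := Qden_add_two hx hirr n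
  have h2 : 2 ≤ Qden x (n + 2) := by nlinarith [hQ n, hQ (n + 1)]
  have h3 : ⌊(gaussOrbit x (n + 1))⁻¹⌋ ≤ Qden x (n + 2) := by nlinarith [hQ n, hQ (n + 1)]
  rw [← Nat.cast_ofNat (n := 3), ← Real.log_pow]
  refine Real.log_le_log (div_pos two_pos hg.1) ?_
  rw [div_eq_mul_inv, inv_gaussOrbit]
  nlinarith [(gaussOrbit_mem hx hirr (n + 2)).2, mul_le_mul h2 h2 zero_le_two (by linarith)]

lemma summable_gauss {α : ℝ} (hα : 0 < α) (hx : x ∈ Set.Ioo (0 : ℝ) 1) (hirr : Irrational x)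
    (hsum : Summable fun n : ℕ => Real.log (Qden x (n + 2)) / Qden x (n + 1) ^ α) :
    Summable fun n => gaussProd x n ^ α * Real.log (2 / gaussOrbit x n) := by
  have hl : ∀ n, 0 ≤ Real.log (2 / gaussOrbit x n) := fun n => by
    obtain ⟨h0, h1⟩ := gaussOrbit_mem hx hirr n
    exact Real.log_nonneg ((one_le_div h0).2 (by linarith))
  have hB := fun n => (gaussProd_pos hx hirr n).le
  rw [← summable_nat_add_iff 1]
  refine (hsum.mul_left 3).of_nonneg_of_le
    (fun n => mul_nonneg (Real.rpow_nonneg (hB _) _) (hl _)) fun n => ?_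
  have hQ : 0 ≤ Qden x (n + 1) := zero_le_one.trans (one_le_Qden hx hirr _)
  calc _ ≤ (Qden x (n + 1))⁻¹ ^ α * (3 * Real.log (Qden x (n + 2))) :=
        mul_le_mul (Real.rpow_le_rpow (hB _) (gaussProd_le_inv_Qden hx hirr n) hα.le)
          (log_two_div_gaussOrbit_le hx hirr n) (hl _)
          (Real.rpow_nonneg (inv_nonneg.2 hQ) _)
    _ = _ := by rw [Real.inv_rpow hQ]; ring

/-- Along the orbit of `Tmap`, the absolute values are `g` or `1 - 1 / (m + g')` with `g`, `g'`
in the Gauss orbit, and the partial sums started there are controlled by tails of the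
corresponding sum along the Gauss orbit. -/
lemma absPartialSum_le {α : ℝ} (hα : 0 < α) (hx : x ∈ Set.Ioo (0 : ℝ) 1) (hirr : Irrational x)
    {V : ℕ → ℝ} (hV0 : ∀ n, 0 ≤ V n)
    (hV : ∀ n, 2 ^ α * (gaussProd x n ^ α * Real.log (2 / gaussOrbit x n)) + V (n + 1) ≤ V n)
    (N : ℕ) :
    (∀ n z, |z| = gaussOrbit x n → gaussProd x n ^ α * absPartialSum α N z ≤ V n) ∧
    ∀ n z, ∀ m : ℕ, ((m + 1 : ℕ) : ℤ) ≤ ⌊(gaussOrbit x n)⁻¹⌋ →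
      |z| = 1 - 1 / ((m + 1 : ℕ) + gaussOrbit x (n + 1)) →
      (gaussProd x (n + 1) * ((m + 1 : ℕ) + gaussOrbit x (n + 1))) ^ α * absPartialSum α N z ≤
        gaussProd x n ^ α * Real.log ((m + 1 : ℕ) + gaussOrbit x (n + 1)) + V (n + 1) := by
  have hg := gaussOrbit_mem hx hirr
  have hB := gaussProd_pos hx hirr
  have h2α : (1 : ℝ) ≤ 2 ^ α := Real.one_le_rpow one_le_two hα.le
  have hBα : ∀ n, 0 ≤ gaussProd x n ^ α := fun n => Real.rpow_nonneg (hB n).le _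
  have hV' : ∀ n, gaussProd x n ^ α * Real.log (1 / gaussOrbit x n) + V (n + 1) ≤ V n := by
    intro n
    obtain ⟨h0, h1⟩ := hg n
    have hlog : Real.log (1 / gaussOrbit x n) ≤ Real.log (2 / gaussOrbit x n) :=
      Real.log_le_log (by positivity) (by gcongr; norm_num)
    have hpos : 0 ≤ gaussProd x n ^ α * Real.log (2 / gaussOrbit x n) :=
      mul_nonneg (hBα n) (Real.log_nonneg ((one_le_div h0).2 (by linarith)))
    nlinarith [hV n, mul_le_mul_of_nonneg_left hlog (hBα n)]
  induction N with
  | zero =>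
    simp only [absPartialSum, mul_zero]
    refine ⟨fun n _ _ => hV0 n, fun n _ m _ _ => add_nonneg (mul_nonneg (hBα n)
      (Real.log_nonneg ?_)) (hV0 _)⟩
    push_cast
    linarith [(hg (n + 1)).1, (Nat.cast_nonneg m : (0 : ℝ) ≤ m)]
  | succ N ih =>
    obtain ⟨iha, ihb⟩ := ih
    -- Both foldings of a point of the Gauss orbit are controlled.
    have key : ∀ n w, |w| = gaussOrbit x n ∨ |w| = 1 - gaussOrbit x n →
        gaussProd x n ^ α * absPartialSum α N w ≤ V n := by
      rintro n w (hw | hw)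
      · exact iha n w hw
      · have ha := one_le_floor_inv_gaussOrbit hx hirr n
        obtain ⟨m, hm⟩ : ∃ m : ℕ, ((m + 1 : ℕ) : ℤ) = ⌊(gaussOrbit x n)⁻¹⌋ :=
          ⟨(⌊(gaussOrbit x n)⁻¹⌋ - 1).toNat, by push_cast; omega⟩
        have hi : ((m + 1 : ℕ) : ℝ) + gaussOrbit x (n + 1) = (gaussOrbit x n)⁻¹ := by
          rw [inv_gaussOrbit x n, ← hm, Int.cast_natCast]
        have := ihb n w m hm.le (by rw [hi, one_div, inv_inv, hw])
        rw [hi, gaussProd_succ, mul_assoc, mul_inv_cancel₀ (hg n).1.ne', mul_one, ← one_div]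
          at this
        exact this.trans (hV' n)
    refine ⟨fun n z hz => ?_, fun n z m hm hz => ?_⟩
    · have hT := abs_Tmap_eq_or (z := z) (by rw [hz, one_div, inv_gaussOrbit])
        (hg (n + 1)).1 (hg (n + 1)).2
      have := key (n + 1) _ hT
      rw [gaussProd_succ, Real.mul_rpow (hB n).le (hg n).1.le] at this
      rw [absPartialSum, hz]
      nlinarith [hV' n]
    · obtain ⟨h0, h1⟩ := hg (n + 1)
      cases m with
      | zero =>
        norm_num at hz ⊢
        have hz' : |z| = gaussOrbit x (n + 1) / (1 + gaussOrbit x (n + 1)) := by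
          rw [hz]; field_simp; ring
        have hinv : 1 / |z| = 1 + (gaussOrbit x (n + 1))⁻¹ := by
          rw [hz']; field_simp; ring
        have hT := abs_Tmap_eq_or (z := z) (m := 1 + ⌊(gaussOrbit x (n + 1))⁻¹⌋)
          (by rw [hinv]; push_cast; linarith [inv_gaussOrbit x (n + 1)]) (hg (n + 2)).1 (hg (n + 2)).2
        have hk := key (n + 2) _ hT
        have hprod : gaussProd x (n + 1) * (1 + gaussOrbit x (n + 1)) * |z|
            = gaussProd x (n + 2) := by
          rw [gaussProd_succ x (n + 1), hz']; field_simp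
        rw [← hprod, Real.mul_rpow (mul_nonneg (hB _).le (by linarith)) (abs_nonneg _)] at hk
        have hlog : Real.log (1 / |z|) ≤ Real.log (2 / gaussOrbit x (n + 1)) := by
          rw [hinv]
          refine Real.log_le_log (by positivity) ?_
          rw [div_eq_mul_inv]
          linarith [(one_le_inv₀ h0).2 h1.le]
        have hlog0 : 0 ≤ Real.log (1 / |z|) := by
          rw [hinv]; exact Real.log_nonneg (by linarith [inv_pos.2 h0])
        have hfac : (gaussProd x (n + 1) * (1 + gaussOrbit x (n + 1))) ^ α
            ≤ 2 ^ α * gaussProd x (n + 1) ^ α := by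
          rw [← Real.mul_rpow zero_le_two (hB _).le]
          exact Real.rpow_le_rpow (mul_nonneg (hB _).le (by linarith))
            (by nlinarith [hB (n + 1)]) hα.le
        have hm1 := mul_le_mul hfac hlog hlog0 (mul_nonneg (by linarith) (hBα _))
        have hnn : 0 ≤ gaussProd x n ^ α * Real.log (1 + gaussOrbit x (n + 1)) :=
          mul_nonneg (hBα n) (Real.log_nonneg (by linarith))
        rw [absPartialSum, mul_add]
        linarith [hV (n + 1)]
      | succ m =>
        have hm0 : (0 : ℝ) ≤ m := Nat.cast_nonneg m
        set s : ℝ := (m + 1 : ℕ) + gaussOrbit x (n + 1) with hs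
        have hs' : ((m + 1 + 1 : ℕ) : ℝ) + gaussOrbit x (n + 1) = s + 1 := by
          rw [hs]; push_cast; ring
        have hs1 : 1 < s := by rw [hs]; push_cast; linarith
        have hle : s + 1 ≤ (gaussOrbit x n)⁻¹ := by
          rw [← hs', inv_gaussOrbit x n]
          gcongr
          exact_mod_cast hm
        rw [hs'] at hz ⊢
        have hz' : |z| = s / (s + 1) := by rw [hz]; field_simp; ring
        have hinv : 1 / |z| = (s + 1) / s := by rw [hz', one_div_div]
        have hs2 : s⁻¹ < 1 := inv_lt_one_of_one_lt₀ hs1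
        have hT : |Tmap z| = 1 - 1 / s := by
          have hab : |1 / s - 1| = 1 - 1 / s := by
            rw [abs_of_neg (by rw [one_div]; linarith)]; ring
          rw [abs_Tmap_eq (k := 1) (h := 1 / s - 1) (by rw [hinv]; push_cast; field_simp; ring)
            (by rw [hab]; have : 0 < 1 / s := by positivity
                linarith), hab]
        have hk := ihb n _ m (by push_cast at hm ⊢; omega) hT
        rw [← hs] at hk
        have hprod : gaussProd x (n + 1) * s = gaussProd x (n + 1) * (s + 1) * |z| := by
          rw [hz']; field_simp
        have hnn : 0 ≤ gaussProd x (n + 1) * (s + 1) := mul_nonneg (hB _).le (by linarith)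
        rw [hprod, Real.mul_rpow hnn (abs_nonneg _)] at hk
        have hlog : Real.log (1 / |z|) = Real.log (s + 1) - Real.log s := by
          rw [hinv, Real.log_div (by linarith) (by linarith)]
        have hlog0 : 0 ≤ Real.log (1 / |z|) := by
          rw [hinv]; exact Real.log_nonneg ((one_le_div (by linarith)).2 (by linarith))
        have hfac : (gaussProd x (n + 1) * (s + 1)) ^ α ≤ gaussProd x n ^ α := by
          refine Real.rpow_le_rpow hnn ?_ hα.le
          rw [gaussProd_succ, mul_assoc]
          refine mul_le_of_le_one_right (hB n).le ?_
          calc _ ≤ gaussOrbit x n * (gaussOrbit x n)⁻¹ := by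
                gcongr; exact (hg n).1.le
            _ = 1 := mul_inv_cancel₀ (hg n).1.ne'
        have hm1 := mul_le_mul_of_nonneg_right hfac hlog0
        rw [absPartialSum, mul_add]
        rw [hlog] at hm1 ⊢
        linarith

end GaussOrbit

/-- convergence of the twisted series with `log(1/|T^j x|)` under
`Σ log(Q_{n+1}) / Q_n^α < ∞`. -/
theorem stmt19 (α : ℝ) (hα : 0 < α)
    (x : ℝ) (hx : x ∈ Set.Ioo (0 : ℝ) 1) (hirr : Irrational x)
    (hsum : Summable (fun n : ℕ => Real.log (Qden x (n + 2)) / Qden x (n + 1) ^ α)) :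
    ∃ L : ℂ, Tendsto (fun N : ℕ => ∑ j ∈ Finset.range N,
      Complex.exp (Real.pi * Complex.I / 4
          * ((∑ ℓ ∈ Finset.range j, Real.sign (Tmap^[ℓ] x) : ℝ) : ℂ))
        * (((∏ ℓ ∈ Finset.range j, |Tmap^[ℓ] x|) ^ α * Real.log (1 / |Tmap^[j] x|) : ℝ) : ℂ))
      atTop (𝓝 L) := by
  have hu := summable_gauss hα hx hirr hsum
  set u : ℕ → ℝ := fun n => gaussProd x n ^ α * Real.log (2 / gaussOrbit x n) with hu_def
  have hu0 : ∀ n, 0 ≤ u n := fun n => by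
    obtain ⟨h0, h1⟩ := gaussOrbit_mem hx hirr n
    exact mul_nonneg (Real.rpow_nonneg (gaussProd_pos hx hirr n).le _)
      (Real.log_nonneg ((one_le_div h0).2 (by linarith)))
  have hbound := fun N => (absPartialSum_le hα hx hirr
    (V := fun n => 2 ^ α * ∑' k, u (k + n))
    (fun n => mul_nonneg (Real.rpow_nonneg zero_le_two _) (tsum_nonneg fun k => hu0 _))
    (fun n => by
      have h := ((summable_nat_add_iff n).2 hu).tsum_eq_zero_add
      simp only [zero_add, add_assoc, add_comm 1 n] at h
      simp only [h, mul_add]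
      exact le_rfl) N).1 0 x (abs_of_pos hx.1)
  simp only [gaussProd, Finset.range_zero, Finset.prod_empty, Real.one_rpow, one_mul,
    absPartialSum_eq_sum] at hbound
  have hT1 : ∀ j, |Tmap^[j] x| ≤ 1 := fun j => by
    cases j with
    | zero => simpa [abs_of_pos hx.1] using hx.2.le
    | succ j =>
      rw [Function.iterate_succ_apply']
      set y := Tmap^[j] x
      have h1 := Int.le_ceil ((-1 / y - 1) / 2)
      have h2 := Int.ceil_lt_add_one ((-1 / y - 1) / 2)
      rw [Tmap, abs_le]
      constructor <;> linarith
  have h0 : ∀ j, 0 ≤ (∏ ℓ ∈ Finset.range j, |Tmap^[ℓ] x|) ^ α * Real.log (1 / |Tmap^[j] x|) :=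
    fun j => by
      refine mul_nonneg (Real.rpow_nonneg (Finset.prod_nonneg fun _ _ => abs_nonneg _) _) ?_
      rw [one_div, Real.log_inv, neg_nonneg]
      exact Real.log_nonpos (abs_nonneg _) (hT1 j)
  have hs : Summable fun j =>
      (∏ ℓ ∈ Finset.range j, |Tmap^[ℓ] x|) ^ α * Real.log (1 / |Tmap^[j] x|) :=
    summable_of_sum_range_le h0 hbound
  refine ⟨_, (Summable.of_norm_bounded hs fun j => ?_).hasSum.tendsto_sum_nat⟩
  rw [norm_mul, Complex.norm_real, Real.norm_of_nonneg (h0 j), Complex.norm_exp]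
  simp
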